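/- There exists an absolute constant C > 0 such that for every integer k ≥ 2 and every connected rainbow graph R on k vertices with minimum degree at least C·log k, the sequence I(R,n)/binom(n,k) converges as n → ∞ to k!/(k^k − k). -/

import Mathlib

open Finset Filter

open scoped Classical

section Defs

variable {T : Type}

/-- A coloring of the complete graph is symmetric. -/
def IsSym {V : Type} (χ : V → V → T) : Prop := ∀ u v, χ u v = χ v u

/-- `copyCount k n R χ` : the number of `k`-element subsets of `Fin n` whose coloring
induced by `χ` is isomorphic (as an edge-colored complete graph) to `R`. -/
noncomputable def copyCount (k n : ℕ) (R : Fin k → Fin k → T) (χ : Fin n → Fin n → T) : ℕ :=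
  ((Finset.powersetCard k (Finset.univ : Finset (Fin n))).filter
    (fun S => ∃ φ : Fin k → Fin n, Function.Injective φ ∧ (∀ a, φ a ∈ S) ∧
      ∀ a b : Fin k, a ≠ b → χ (φ a) (φ b) = R a b)).card

/-- `maxCopyCount k n R = I(R,n)` : the maximum of `copyCount` over all symmetric
`T`-colorings of the complete graph on `n` vertices. -/
noncomputable def maxCopyCount [Fintype T] (k n : ℕ) (R : Fin k → Fin k → T) : ℕ :=
  Finset.sup ((Finset.univ : Finset (Fin n → Fin n → T)).filter (fun χ => IsSym χ))
    (fun χ => copyCount k n R χ)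

/-- `vertDeg k n R χ x = d(x)` : the number of `k`-subsets containing `x` whose induced
coloring is isomorphic to `R`. -/
noncomputable def vertDeg (k n : ℕ) (R : Fin k → Fin k → T) (χ : Fin n → Fin n → T)
    (x : Fin n) : ℕ :=
  ((Finset.powersetCard k (Finset.univ : Finset (Fin n))).filter
    (fun S => x ∈ S ∧ ∃ φ : Fin k → Fin n, Function.Injective φ ∧ (∀ a, φ a ∈ S) ∧
      ∀ a b : Fin k, a ≠ b → χ (φ a) (φ b) = R a b)).card

/-- `embCount k n R χ i x = d_i(x)` : the number of injective color-preserving maps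
`φ : Fin k → Fin n` with `φ i = x`. -/
noncomputable def embCount (k n : ℕ) (R : Fin k → Fin k → T) (χ : Fin n → Fin n → T)
    (i : Fin k) (x : Fin n) : ℕ :=
  ((Finset.univ : Finset (Fin k → Fin n)).filter
    (fun φ => Function.Injective φ ∧ φ i = x ∧
      ∀ a b : Fin k, a ≠ b → χ (φ a) (φ b) = R a b)).card

/-- `Nset k n R χ i x = N_i(x)` : the set of vertices `y ≠ x` lying in the image of some
injective color-preserving map `φ : Fin k → Fin n` with `φ i = x`. -/
noncomputable def Nset (k n : ℕ) (R : Fin k → Fin k → T) (χ : Fin n → Fin n → T)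
    (i : Fin k) (x : Fin n) : Finset (Fin n) :=
  (Finset.univ : Finset (Fin n)).filter
    (fun y => y ≠ x ∧ ∃ φ : Fin k → Fin n, Function.Injective φ ∧ φ i = x ∧
      (∀ a b : Fin k, a ≠ b → χ (φ a) (φ b) = R a b) ∧ ∃ a, φ a = y)

/-- `colorDeg χ x c = d_c(x)` : the number of vertices `y ≠ x` with `χ x y = c`. -/
noncomputable def colorDeg {n : ℕ} (χ : Fin n → Fin n → T) (x : Fin n) (c : T) : ℕ :=
  ((Finset.univ : Finset (Fin n)).filter (fun y => y ≠ x ∧ χ x y = c)).card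

end Defs

/-- The rainbow `k`-clique: the edge `ij` gets color `{i,j}`. -/
def rainbowClique (k : ℕ) : Fin k → Fin k → Finset (Fin k) := fun i j => {i, j}

/-- A rainbow graph `G` on `[k]`, viewed as an edge-colored complete graph: edges `ij ∈ E`
get color `{i,j}`, non-edges get color `∅`. -/
noncomputable def rainbowOf {k : ℕ} (G : SimpleGraph (Fin k)) :
    Fin k → Fin k → Finset (Fin k) :=
  fun i j => if G.Adj i j then {i, j} else ∅

/-- `B(x)` : the set of neighbors of `x`, i.e. vertices joined to `x` by a non-`∅` color. -/
noncomputable def Bset {k n : ℕ} (χ : Fin n → Fin n → Finset (Fin k)) (x : Fin n) :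
    Finset (Fin n) :=
  (Finset.univ : Finset (Fin n)).filter (fun y => y ≠ x ∧ χ x y ≠ ∅)

/-- The degree of vertex `i` in the graph `G`. -/
noncomputable def degR {k : ℕ} (G : SimpleGraph (Fin k)) (i : Fin k) : ℕ :=
  ((Finset.univ : Finset (Fin k)).filter (fun j => G.Adj i j)).card

section Rigidity

variable {k : ℕ} {G : SimpleGraph (Fin k)}

lemma rainbowOf_comm (G : SimpleGraph (Fin k)) (a b : Fin k) :
    rainbowOf G a b = rainbowOf G b a := by
  simp only [rainbowOf, G.adj_comm a b, Finset.pair_comm a b]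

lemma rainbowOf_of_adj {a b : Fin k} (h : G.Adj a b) : rainbowOf G a b = {a, b} := by
  simp [rainbowOf, h]

lemma rainbowOf_eq_pair {a b c d : Fin k} (h : rainbowOf G a b = {c, d}) :
    G.Adj a b ∧ ({a, b} : Finset (Fin k)) = {c, d} := by
  unfold rainbowOf at h
  split_ifs at h with hab
  · exact ⟨hab, h⟩
  · exact absurd h.symm (Finset.insert_ne_empty _ _)

lemma pair_eq_pair_left {a b c : Fin k} (h : ({a, b} : Finset (Fin k)) = {a, c}) : b = c := by
  have hb : b ∈ ({a, c} : Finset (Fin k)) := h ▸ by simp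
  have hc : c ∈ ({a, b} : Finset (Fin k)) := h ▸ by simp
  simp only [Finset.mem_insert, Finset.mem_singleton] at hb hc
  grind

/-- In a connected rainbow graph of minimum degree at least two, a self-map that respects the
colors of all pairs it separates is constant or the identity. -/
lemma rainbowOf_rigid (hG : G.Connected) (hdeg : ∀ i j, ∃ c, G.Adj i c ∧ c ≠ j)
    (f : Fin k → Fin k)
    (hf : ∀ a b, f a ≠ f b → rainbowOf G a b = rainbowOf G (f a) (f b)) :
    (∀ a b, f a = f b) ∨ ∀ a, f a = a := by
  by_cases hconst : ∀ a b, G.Adj a b → f a = f b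
  · left
    intro a b
    obtain ⟨p⟩ := hG.preconnected a b
    induction p with
    | nil => rfl
    | cons h _ ih => exact (hconst _ _ h).trans ih
  push Not at hconst
  obtain ⟨a, b, hab, hne⟩ := hconst
  have hpair : ∀ {a b}, G.Adj a b → f a ≠ f b → ({f a, f b} : Finset (Fin k)) = {a, b} :=
    fun {a b} hab hne =>
      (rainbowOf_eq_pair ((hf a b hne).symm.trans (rainbowOf_of_adj hab))).2
  have hfa : f a = a ∨ f a = b := by
    have : f a ∈ ({a, b} : Finset (Fin k)) := hpair hab hne ▸ by simp
    simpa using this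
  rcases hfa with hfa | hfa
  · have hfb : f b = b := by
      have := hpair hab hne
      rw [hfa] at this
      exact pair_eq_pair_left this
    right
    have key : ∀ {a c : Fin k}, G.Adj a c → (f a = a ∧ ∃ b, G.Adj a b ∧ f b = b) →
        (f c = c ∧ ∃ b, G.Adj c b ∧ f b = b) := by
      rintro a c hac ⟨ha, b, hab, hb⟩
      refine ⟨?_, a, hac.symm, ha⟩
      by_cases h : f a = f c
      · exfalso
        have hcb : f c ≠ f b := by rw [← h, ha, hb]; exact hab.ne
        have h1 := hf c b hcb
        rw [← h, ha, hb, rainbowOf_of_adj hab] at h1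
        have h2 := (rainbowOf_eq_pair h1).2
        rw [Finset.pair_comm c b, Finset.pair_comm a b] at h2
        exact hac.ne (pair_eq_pair_left h2).symm
      · have := hpair hac h
        rw [ha] at this
        exact pair_eq_pair_left this
    intro c
    have : f c = c ∧ ∃ b, G.Adj c b ∧ f b = b := by
      obtain ⟨p⟩ := hG.preconnected a c
      have h0 : f a = a ∧ ∃ b, G.Adj a b ∧ f b = b := ⟨hfa, b, hab, hfb⟩
      clear hab hne hfa hfb
      induction p with
      | nil => exact h0
      | cons h _ ih => exact ih (key h h0)
    exact this.1
  · exfalso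
    have hfb : f b = a := by
      have := hpair hab hne
      rw [hfa, Finset.pair_comm a b] at this
      exact pair_eq_pair_left this
    obtain ⟨c, hac, hcb⟩ := hdeg a b
    have hc : f a = f c := by
      by_contra h
      have h1 := hpair hac h
      have : b ∈ ({a, c} : Finset (Fin k)) := h1 ▸ by simp [hfa]
      simp only [Finset.mem_insert, Finset.mem_singleton] at this
      rcases this with h | h
      · exact hab.ne h.symm
      · exact hcb h.symm
    have h1 := hf c b (by rw [← hc]; exact hne)
    rw [← hc, hfa, hfb, rainbowOf_of_adj hab.symm] at h1
    have h2 := (rainbowOf_eq_pair h1).2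
    rw [Finset.pair_comm c b] at h2
    exact hac.ne (pair_eq_pair_left h2).symm

end Rigidity

section MeanInequality

lemma card_mul_prod_le_sum {k : ℕ} (hk : 0 < k) (y : Fin k → ℝ) (hy : ∀ i, 0 ≤ y i) {p : ℝ}
    (hp : 0 ≤ p) (h : ∏ i, y i = p ^ k) : k * p ≤ ∑ i, y i := by
  have hk' : (0 : ℝ) < k := by exact_mod_cast hk
  have := Real.geom_mean_le_arith_mean Finset.univ (fun _ : Fin k => (1 : ℝ)) y
    (fun _ _ => zero_le_one) (by simpa using hk') (fun i _ => hy i)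
  simp only [Real.rpow_one, h, Finset.sum_const, Finset.card_univ, Fintype.card_fin,
    nsmul_eq_mul, mul_one, one_mul] at this
  rw [Real.pow_rpow_inv_natCast hp hk.ne', le_div_iff₀ hk'] at this
  linarith

/-- The balanced point maximizes the product relative to the non-pure part of the `k`-th power
of the sum. -/
lemma pow_sub_self_mul_prod_le {k : ℕ} (hk : 0 < k) (x : Fin k → ℝ) (hx : ∀ i, 0 ≤ x i) :
    ((k : ℝ) ^ k - k) * ∏ i, x i ≤ (∑ i, x i) ^ k - ∑ i, x i ^ k := by
  have : NeZero k := ⟨hk.ne'⟩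
  have hk' : (0 : ℝ) < k := by exact_mod_cast hk
  set K : Finset (Fin k → Fin k) := Finset.univ.image (fun c _ => c) with hK
  have hinj : Function.Injective (fun (c : Fin k) (_ : Fin k) => c) :=
    fun c d h => congrFun h 0
  have hKsum : ∑ g ∈ K, ∏ j, x (g j) = ∑ i, x i ^ k := by
    rw [hK, Finset.sum_image (fun a _ b _ h => hinj h)]
    simp
  have hcard : (Kᶜ.card : ℝ) = (k : ℝ) ^ k - k := by
    have h1 := Finset.card_add_card_compl K
    rw [hK, Finset.card_image_of_injective _ hinj] at h1
    simp only [Finset.card_univ, Fintype.card_fin, Fintype.card_fun] at h1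
    have h2 : ((k : ℝ) + (Kᶜ.card : ℝ)) = (k : ℝ) ^ k := by exact_mod_cast h1
    linarith
  have hsum : (∑ i, x i) ^ k - ∑ i, x i ^ k = ∑ g ∈ Kᶜ, ∏ j, x (g j) := by
    rw [Fintype.sum_pow, ← Finset.sum_add_sum_compl K, hKsum]
    ring
  have hshift : ∀ c : Fin k, ∑ g ∈ Kᶜ, ∏ j, x (g j + c) = ∑ g ∈ Kᶜ, ∏ j, x (g j) := by
    intro c
    refine Finset.sum_bij' (fun g _ j => g j + c) (fun g _ j => g j - c) ?_ ?_ ?_ ?_ ?_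
    · intro g hg
      simp only [hK, Finset.mem_compl, Finset.mem_image, Finset.mem_univ, true_and,
        not_exists] at hg ⊢
      intro d hd
      exact hg (d - c) (funext fun j => sub_eq_of_eq_add (congrFun hd j))
    · intro g hg
      simp only [hK, Finset.mem_compl, Finset.mem_image, Finset.mem_univ, true_and,
        not_exists] at hg ⊢
      intro d hd
      exact hg (d + c) (funext fun j => eq_sub_iff_add_eq.mp (congrFun hd j))
    · intro g _; simp
    · intro g _; simp
    · intro g _; rfl
  have hword : ∀ g : Fin k → Fin k, k * ∏ i, x i ≤ ∑ c, ∏ j, x (g j + c) := by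
    intro g
    refine card_mul_prod_le_sum hk _ (fun c => Finset.prod_nonneg fun j _ => hx _)
      (Finset.prod_nonneg fun j _ => hx _) ?_
    rw [Finset.prod_comm]
    have : ∀ j, ∏ c, x (g j + c) = ∏ i, x i :=
      fun j => Equiv.prod_comp (Equiv.addLeft (g j)) x
    simp [this]
  have h1 : (k : ℝ) * ∑ g ∈ Kᶜ, ∏ j, x (g j) = ∑ g ∈ Kᶜ, ∑ c, ∏ j, x (g j + c) := by
    rw [Finset.sum_comm]
    simp [hshift]
  have h2 : ∑ g ∈ Kᶜ, ((k : ℝ) * ∏ i, x i) ≤ ∑ g ∈ Kᶜ, ∑ c, ∏ j, x (g j + c) :=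
    Finset.sum_le_sum fun g _ => hword g
  rw [Finset.sum_const, nsmul_eq_mul, hcard, ← h1] at h2
  rw [hsum]
  refine le_of_mul_le_mul_left ?_ hk'
  linarith

end MeanInequality

section Density

variable {T V : Type} [Fintype V] {k : ℕ}

/-- The injective color-preserving maps from the pattern `R` into the colored graph `χ`. -/
noncomputable def embeddings (R : Fin k → Fin k → T) (χ : V → V → T) : Finset (Fin k → V) :=
  Finset.univ.filter fun φ => Function.Injective φ ∧ ∀ a b, a ≠ b → χ (φ a) (φ b) = R a b

lemma mem_embeddings {R : Fin k → Fin k → T} {χ : V → V → T} {φ : Fin k → V} :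
    φ ∈ embeddings R χ ↔ Function.Injective φ ∧ ∀ a b, a ≠ b → χ (φ a) (φ b) = R a b := by
  simp [embeddings]

/-- The total weight of the copies of `R` in `χ` with respect to the vertex weights `w`. -/
noncomputable def copyWeight (R : Fin k → Fin k → T) (χ : V → V → T) (w : V → ℝ) : ℝ :=
  ∑ φ ∈ embeddings R χ, ∏ a, w (φ a)

/-- The vertex weights `w` form a probability vector maximizing the weight of the copies
of `R`; maximality is recorded in homogeneous form. -/
structure IsOptimal (R : Fin k → Fin k → T) (χ : V → V → T) (w : V → ℝ) : Prop where
  nonneg : ∀ x, 0 ≤ w x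
  sum_eq_one : ∑ x, w x = 1
  copyWeight_le : ∀ w' : V → ℝ, (∀ x, 0 ≤ w' x) →
    copyWeight R χ w' ≤ copyWeight R χ w * (∑ x, w' x) ^ k

lemma copyWeight_nonneg (R : Fin k → Fin k → T) (χ : V → V → T) {w : V → ℝ}
    (hw : ∀ x, 0 ≤ w x) : 0 ≤ copyWeight R χ w :=
  Finset.sum_nonneg fun _ _ => Finset.prod_nonneg fun _ _ => hw _

lemma copyWeight_smul (R : Fin k → Fin k → T) (χ : V → V → T) (c : ℝ) (w : V → ℝ) :
    copyWeight R χ (fun x => c * w x) = c ^ k * copyWeight R χ w := by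
  simp [copyWeight, Finset.prod_mul_distrib, Finset.mul_sum]

lemma exists_isOptimal [Nonempty V] (hk : 0 < k) (R : Fin k → Fin k → T) (χ : V → V → T) :
    ∃ w, IsOptimal R χ w := by
  have hne : (stdSimplex ℝ V).Nonempty :=
    ⟨_, single_mem_stdSimplex ℝ (Classical.arbitrary V)⟩
  have hcont : Continuous (fun w : V → ℝ => copyWeight R χ w) := by
    unfold copyWeight
    fun_prop
  obtain ⟨w, hw, hmax⟩ := (isCompact_stdSimplex ℝ V).exists_isMaxOn hne hcont.continuousOn
  refine ⟨w, hw.1, hw.2, fun w' hw' => ?_⟩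
  rcases (Finset.sum_nonneg fun x (_ : x ∈ Finset.univ) => hw' x).eq_or_lt with hs | hs
  · have hz : ∀ x, w' x = 0 := fun x =>
      (Finset.sum_eq_zero_iff_of_nonneg fun x _ => hw' x).1 hs.symm x (Finset.mem_univ x)
    have : w' = fun x => 0 * w x := funext fun x => by simp [hz]
    rw [← hs, this, copyWeight_smul]
    simp [hk.ne']
  · have hmem : (fun x => (∑ y, w' y)⁻¹ * w' x) ∈ stdSimplex ℝ V := by
      refine ⟨fun x => mul_nonneg (inv_nonneg.2 hs.le) (hw' x), ?_⟩
      rw [← Finset.mul_sum, inv_mul_cancel₀ hs.ne']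
    have h := hmax hmem
    simp only [Set.mem_ofPred_eq, copyWeight_smul] at h
    rwa [inv_pow, inv_mul_le_iff₀ (pow_pos hs k), mul_comm] at h

/-- Weight of the copies in which `x` plays the role `i`. -/
noncomputable def roleWeight (R : Fin k → Fin k → T) (χ : V → V → T) (w : V → ℝ) (i : Fin k)
    (x : V) : ℝ :=
  ∑ φ ∈ (embeddings R χ).filter (fun φ => φ i = x), ∏ a, w (φ a)

namespace IsOptimal

variable {R : Fin k → Fin k → T} {χ : V → V → T} {w : V → ℝ}

lemma sum_le (hw : IsOptimal R χ w) {F : Finset (Fin k → V)} (hF : F ⊆ embeddings R χ)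
    (w' : V → ℝ) (hw' : ∀ x, 0 ≤ w' x) :
    ∑ φ ∈ F, ∏ a, w' (φ a) ≤ copyWeight R χ w * (∑ x, w' x) ^ k :=
  (Finset.sum_le_sum_of_subset_of_nonneg hF
    fun _ _ _ => Finset.prod_nonneg fun _ _ => hw' _).trans (hw.copyWeight_le w' hw')

lemma le_one (hw : IsOptimal R χ w) (x : V) : w x ≤ 1 := by
  rw [← hw.sum_eq_one]
  exact Finset.single_le_sum (fun y _ => hw.nonneg y) (Finset.mem_univ x)

/-- Shrinking the weight of a single vertex costs at most the first-order loss. -/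
lemma sum_roleWeight_ge (hw : IsOptimal R χ w) (hk : 0 < k) (x : V) :
    k * (copyWeight R χ w * w x / 2) ≤ ∑ i, roleWeight R χ w i x := by
  set P := copyWeight R χ w with hP
  have hP0 : 0 ≤ P := copyWeight_nonneg R χ hw.nonneg
  have hk' : (1 : ℝ) ≤ k := by exact_mod_cast hk
  set z := w x
  have hz0 : 0 ≤ z := hw.nonneg x
  have hz1 : z ≤ 1 := hw.le_one x
  set c : ℝ := 1 - (k : ℝ)⁻¹ with hc
  have hkinv : (k : ℝ)⁻¹ ≤ 1 := inv_le_one_of_one_le₀ hk'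
  have hkinv0 : (0 : ℝ) < (k : ℝ)⁻¹ := by positivity
  have hc0 : 0 ≤ c := by linarith
  set w' : V → ℝ := fun y => (if y = x then c else 1) * w y with hw'
  have hw'0 : ∀ y, 0 ≤ w' y := fun y => mul_nonneg (by split_ifs <;> linarith) (hw.nonneg y)
  have hsum : ∑ y, w' y = 1 - z / k := by
    have : ∀ y, w' y = w y - (if y = x then z * (k : ℝ)⁻¹ else 0) := by
      intro y
      simp only [hw', hc]
      split_ifs with h
      · subst h; ring
      · ring
    simp only [this, Finset.sum_sub_distrib, hw.sum_eq_one]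
    simp [div_eq_mul_inv]
  have hterm : ∀ φ ∈ embeddings R χ, ∏ a, w (φ a) - (k : ℝ)⁻¹ *
      ∑ i, (if φ i = x then ∏ a, w (φ a) else 0) ≤ ∏ a, w' (φ a) := by
    intro φ hφ
    simp only [hw', Finset.prod_mul_distrib]
    by_cases h : ∃ i, φ i = x
    · obtain ⟨i, rfl⟩ := h
      have hi : ∀ a, (φ a = φ i) = (a = i) := fun a => by
        rw [(mem_embeddings.1 hφ).1.eq_iff]
      simp only [hi, Finset.sum_ite_eq', Finset.prod_ite_eq', Finset.mem_univ, if_true, hc]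
      linarith
    · push Not at h
      simp [h]
  have hrole : ∑ φ ∈ embeddings R χ, ∑ i, (if φ i = x then ∏ a, w (φ a) else 0) =
      ∑ i, roleWeight R χ w i x := by
    rw [Finset.sum_comm]
    simp [roleWeight, Finset.sum_filter]
  have h1 : P - (k : ℝ)⁻¹ * ∑ i, roleWeight R χ w i x ≤ P * (1 - z / k) ^ k := by
    rw [← hsum, ← hrole, hP, copyWeight, Finset.mul_sum, ← Finset.sum_sub_distrib]
    exact (Finset.sum_le_sum hterm).trans (hw.copyWeight_le w' hw'0)
  have h2 : (1 - z / k) ^ k ≤ 1 - z / 2 := by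
    have hzk : z / k ≤ 1 := (div_le_one (by linarith)).2 (hz1.trans hk')
    have hzk0 : 0 ≤ z / k := by positivity
    have hb : 1 + z ≤ (1 + z / k) ^ k := by
      have := one_add_mul_le_pow (show (-2 : ℝ) ≤ z / k by linarith) k
      rwa [mul_div_cancel₀ _ (by linarith : (k : ℝ) ≠ 0)] at this
    have hm : (1 - z / k) ^ k * (1 + z / k) ^ k ≤ 1 := by
      rw [← mul_pow]
      exact pow_le_one₀ (mul_nonneg (by linarith) (by linarith)) (by nlinarith)
    have hn : 0 ≤ (1 - z / k) ^ k := pow_nonneg (by linarith) k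
    have hm2 : (1 - z / k) ^ k * (1 + z) ≤ 1 :=
      (mul_le_mul_of_nonneg_left hb hn).trans hm
    by_contra hcon
    push Not at hcon
    nlinarith
  have h3 : P * (z / 2) ≤ (k : ℝ)⁻¹ * ∑ i, roleWeight R χ w i x := by
    have := mul_le_mul_of_nonneg_left h2 hP0
    linarith
  rw [le_inv_mul_iff₀ (by linarith)] at h3
  linarith

lemma exists_roleWeight_ge (hw : IsOptimal R χ w) (hk : 0 < k) (x : V) :
    ∃ i, copyWeight R χ w * w x / 2 ≤ roleWeight R χ w i x := by
  have : Nonempty (Fin k) := ⟨⟨0, hk⟩⟩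
  by_contra! h
  have h1 := Finset.sum_lt_sum_of_nonempty Finset.univ_nonempty fun i _ => h i
  have h2 := hw.sum_roleWeight_ge hk x
  simp only [Finset.sum_const, Finset.card_univ, Fintype.card_fin, nsmul_eq_mul] at h1
  linarith

end IsOptimal

end Density

section Roles

variable {V : Type} [Fintype V] {k : ℕ} {G : SimpleGraph (Fin k)}
  {χ : V → V → Finset (Fin k)} {w : V → ℝ}

/-- The vertices joined to `x` by a color `{i, c}` with `c ≠ j` a neighbor of `i`. -/
noncomputable def roleNbhd (G : SimpleGraph (Fin k)) (χ : V → V → Finset (Fin k))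
    (i j : Fin k) (x : V) : Finset V :=
  Finset.univ.filter fun y => y ≠ x ∧ ∃ c, G.Adj i c ∧ c ≠ j ∧ χ x y = {i, c}

lemma mem_roleNbhd {i j : Fin k} {x y : V} :
    y ∈ roleNbhd G χ i j x ↔ y ≠ x ∧ ∃ c, G.Adj i c ∧ c ≠ j ∧ χ x y = {i, c} := by
  simp [roleNbhd]

lemma one_add_pow_le_exp {z : ℝ} (hz : 0 ≤ 1 + z) (k : ℕ) :
    (1 + z) ^ k ≤ Real.exp (k * z) := by
  rw [Real.exp_nat_mul]
  exact pow_le_pow_left₀ hz (by linarith [Real.add_one_le_exp z]) k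

lemma half_lt_log {k : ℕ} (hk : 2 ≤ k) : (1 / 2 : ℝ) < Real.log k := by
  have h2 : Real.log 2 ≤ Real.log k :=
    Real.log_le_log (by norm_num) (by exact_mod_cast hk)
  linarith [Real.log_two_gt_d9]

lemma degR_le_card_erase_add_one (G : SimpleGraph (Fin k)) (i j : Fin k) :
    degR G i ≤ (Finset.univ.filter fun c => G.Adj i c ∧ c ≠ j).card + 1 := by
  have : (Finset.univ.filter fun c => G.Adj i c ∧ c ≠ j) =
      (Finset.univ.filter fun c => G.Adj i c).erase j := by
    ext c
    simp [and_comm]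
  rw [this, degR]
  exact Nat.sub_le_iff_le_add.1 Finset.pred_card_le_card_erase

lemma IsOptimal.le_sum_roleNbhd (hw : IsOptimal (rainbowOf G) χ w) (hk : 2 ≤ k)
    (hP : 0 < copyWeight (rainbowOf G) χ w) {i : Fin k}
    (hdeg : 40 * Real.log k ≤ degR G i) {x : V} (hx : 0 < w x)
    (hi : copyWeight (rainbowOf G) χ w * w x / 2 ≤ roleWeight (rainbowOf G) χ w i x)
    (j : Fin k) : 10 * Real.log k / k ≤ ∑ y ∈ roleNbhd G χ i j x, w y := by
  set P := copyWeight (rainbowOf G) χ w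
  set N := roleNbhd G χ i j x with hN
  set δ := ∑ y ∈ N, w y
  set J : Finset (Fin k) := Finset.univ.filter fun c => G.Adj i c ∧ c ≠ j with hJ
  have hk0 : (0 : ℝ) < k := by exact_mod_cast (by omega : 0 < k)
  have hlog := half_lt_log hk
  have he := Real.exp_one_lt_d9
  have he1 := Real.exp_one_gt_d9
  have hδ0 : 0 ≤ δ := Finset.sum_nonneg fun y _ => hw.nonneg y
  by_contra! hcon
  set w' : V → ℝ := fun y => if y = x then (k : ℝ)⁻¹ else
    (if y ∈ N then Real.exp 1 else 1) * w y with hw'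
  have hw'0 : ∀ y, 0 ≤ w' y := by
    intro y
    simp only [hw']
    have := hw.nonneg y
    split_ifs <;> positivity
  have hsum : ∑ y, w' y ≤ 1 + ((k : ℝ)⁻¹ + 2 * δ) := by
    have h1 : ∀ y, w' y ≤ (if y = x then (k : ℝ)⁻¹ else 0) + w y +
        2 * (if y ∈ N then w y else 0) := by
      intro y
      have := hw.nonneg y
      simp only [hw']
      split_ifs <;> nlinarith
    refine (Finset.sum_le_sum fun y _ => h1 y).trans (le_of_eq ?_)
    rw [Finset.sum_add_distrib, Finset.sum_add_distrib, ← Finset.mul_sum, hw.sum_eq_one]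
    simp only [Finset.sum_ite_eq', Finset.sum_ite_mem, Finset.mem_univ, if_true,
      Finset.univ_inter]
    ring
  have hterm : ∀ φ ∈ (embeddings (rainbowOf G) χ).filter (fun φ => φ i = x),
      ∏ a, w (φ a) ≤ (k * w x) * (Real.exp 1)⁻¹ ^ J.card * ∏ a, w' (φ a) := by
    intro φ hφ
    rw [Finset.mem_filter, mem_embeddings] at hφ
    obtain ⟨⟨hinj, hcol⟩, hφi⟩ := hφ
    have hprod : (k * w x) * (Real.exp 1)⁻¹ ^ J.card =
        ∏ c, ((if c = i then k * w x else 1) * (if c ∈ J then (Real.exp 1)⁻¹ else 1)) := by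
      rw [Finset.prod_mul_distrib, Finset.prod_ite_eq', Finset.prod_ite_mem]
      simp
    rw [hprod, ← Finset.prod_mul_distrib]
    refine Finset.prod_le_prod (fun c _ => hw.nonneg _) fun c _ => ?_
    by_cases hci : c = i
    · subst hci
      have : c ∉ J := by simp [hJ]
      simp only [hw', hφi, this, if_true, if_false]
      field_simp
      rfl
    · have hne : φ c ≠ x := fun h => hci (hinj (h.trans hφi.symm))
      by_cases hcJ : c ∈ J
      · have hcN : φ c ∈ N := by
          simp only [hJ, Finset.mem_filter, Finset.mem_univ, true_and] at hcJ
          refine mem_roleNbhd.2 ⟨hne, c, hcJ.1, hcJ.2, ?_⟩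
          rw [← hφi, hcol i c (Ne.symm hci), rainbowOf_of_adj hcJ.1]
        simp only [hw', hci, hcJ, hne, hcN, if_true, if_false]
        have := Real.exp_pos 1
        field_simp
        rfl
      · simp only [hw', hci, hcJ, hne, if_false, one_mul]
        have := hw.nonneg (φ c)
        split_ifs <;> nlinarith
  have hrole : roleWeight (rainbowOf G) χ w i x ≤
      (k * w x) * (Real.exp 1)⁻¹ ^ J.card * (P * (1 + ((k : ℝ)⁻¹ + 2 * δ)) ^ k) := by
    refine (Finset.sum_le_sum hterm).trans ?_
    rw [← Finset.mul_sum]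
    refine mul_le_mul_of_nonneg_left ?_ (by positivity)
    refine (hw.sum_le (Finset.filter_subset _ _) w' hw'0).trans ?_
    exact mul_le_mul_of_nonneg_left
      (pow_le_pow_left₀ (Finset.sum_nonneg fun y _ => hw'0 y) hsum k) hP.le
  have hexp : (1 + ((k : ℝ)⁻¹ + 2 * δ)) ^ k ≤ Real.exp (1 + 20 * Real.log k) := by
    refine (one_add_pow_le_exp (by positivity) k).trans (Real.exp_le_exp.2 ?_)
    rw [lt_div_iff₀ hk0] at hcon
    have : (k : ℝ) * ((k : ℝ)⁻¹ + 2 * δ) = 1 + 2 * (δ * k) := by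
      field_simp
    linarith
  have hJcard : (Real.exp 1)⁻¹ ^ J.card ≤ Real.exp (1 - 40 * Real.log k) := by
    rw [← Real.exp_neg, ← Real.exp_nat_mul]
    refine Real.exp_le_exp.2 ?_
    have h1 : (degR G i : ℝ) ≤ J.card + 1 := by
      exact_mod_cast degR_le_card_erase_add_one G i j
    linarith
  have hfinal : P * w x / 2 ≤ P * w x * Real.exp (2 - 19 * Real.log k) := by
    refine (hi.trans hrole).trans ?_
    have h1 : (Real.exp 1)⁻¹ ^ J.card * (1 + ((k : ℝ)⁻¹ + 2 * δ)) ^ k ≤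
        Real.exp (1 - 40 * Real.log k) * Real.exp (1 + 20 * Real.log k) :=
      mul_le_mul hJcard hexp (by positivity) (Real.exp_pos _).le
    have h2 : Real.exp (2 - 19 * Real.log k) =
        k * (Real.exp (1 - 40 * Real.log k) * Real.exp (1 + 20 * Real.log k)) := by
      nth_rewrite 2 [← Real.exp_log hk0]
      rw [← Real.exp_add, ← Real.exp_add]
      congr 1
      ring
    rw [h2]
    calc _ = (P * w x * k) * ((Real.exp 1)⁻¹ ^ J.card * (1 + ((k : ℝ)⁻¹ + 2 * δ)) ^ k) := by ring
      _ ≤ (P * w x * k) *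
          (Real.exp (1 - 40 * Real.log k) * Real.exp (1 + 20 * Real.log k)) :=
        mul_le_mul_of_nonneg_left h1 (by positivity)
      _ = _ := by ring
  have hsmall : Real.exp (2 - 19 * Real.log k) < 1 / 2 := by
    calc Real.exp (2 - 19 * Real.log k) ≤ Real.exp (-1) := Real.exp_le_exp.2 (by linarith)
      _ = (Real.exp 1)⁻¹ := Real.exp_neg 1
      _ < 1 / 2 := by
        rw [inv_eq_one_div]
        exact one_div_lt_one_div_of_lt (by norm_num) (by linarith)
  have : 0 < P * w x := mul_pos hP hx
  nlinarith

/-- Every vertex of positive weight has a role `r x` such that the color classes of this role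
occupy a substantial part of its neighborhood. -/
def IsRoleMap (G : SimpleGraph (Fin k)) (χ : V → V → Finset (Fin k)) (w : V → ℝ)
    (r : V → Fin k) : Prop :=
  ∀ x, 0 < w x → ∀ j, 10 * Real.log k / k ≤ ∑ y ∈ roleNbhd G χ (r x) j x, w y

lemma IsOptimal.exists_isRoleMap (hw : IsOptimal (rainbowOf G) χ w) (hk : 2 ≤ k)
    (hP : 0 < copyWeight (rainbowOf G) χ w) (hdeg : ∀ i, 40 * Real.log k ≤ degR G i) :
    ∃ r, IsRoleMap G χ w r := by
  choose r hr using hw.exists_roleWeight_ge (by omega : 0 < k)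
  exact ⟨r, fun x hx j => hw.le_sum_roleNbhd hk hP (hdeg _) hx (hr x) j⟩

/-- The copies containing two given vertices, one of which plays a wrong role, have
negligible weight. -/
lemma IsOptimal.sum_pair_le (hw : IsOptimal (rainbowOf G) χ w) (hk : 2 ≤ k) {r : V → Fin k}
    (hr : IsRoleMap G χ w r) {a b : Fin k} (hab : a ≠ b) {u v : V} (hu : r u ≠ a) :
    ∑ φ ∈ (embeddings (rainbowOf G) χ).filter (fun φ => φ a = u ∧ φ b = v), ∏ c, w (φ c) ≤
      copyWeight (rainbowOf G) χ w * Real.exp (2 - 8 * Real.log k) * (w u * w v) := by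
  set P := copyWeight (rainbowOf G) χ w
  have hP0 : 0 ≤ P := copyWeight_nonneg _ χ hw.nonneg
  have hk0 : (0 : ℝ) < k := by exact_mod_cast (by omega : 0 < k)
  rcases (hw.nonneg u).eq_or_lt with hu0 | hu0
  · rw [← hu0]
    refine (Finset.sum_eq_zero fun φ hφ => ?_).le.trans (by simp)
    rw [Finset.mem_filter] at hφ
    exact Finset.prod_eq_zero (Finset.mem_univ a) (by rw [hφ.2.1, ← hu0])
  set S := roleNbhd G χ (r u) a u with hS
  have hκ := hr u hu0 a
  set w' : V → ℝ := fun y => if y = u ∨ y = v then (k : ℝ)⁻¹ else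
    if y ∈ S then 0 else w y with hw'
  have hw'0 : ∀ y, 0 ≤ w' y := by
    intro y
    simp only [hw']
    have := hw.nonneg y
    split_ifs <;> positivity
  have hsum : ∑ y, w' y ≤ 1 + (2 * (k : ℝ)⁻¹ - 10 * Real.log k / k) := by
    have hkinv : (0 : ℝ) < (k : ℝ)⁻¹ := by positivity
    have h1 : ∀ y, w' y ≤ (if y = u then (k : ℝ)⁻¹ else 0) + (if y = v then (k : ℝ)⁻¹ else 0) +
        (w y - (if y ∈ S then w y else 0)) := by
      intro y
      have := hw.nonneg y
      simp only [hw']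
      split_ifs <;> first | linarith | tauto
    refine (Finset.sum_le_sum fun y _ => h1 y).trans ?_
    rw [Finset.sum_add_distrib, Finset.sum_add_distrib, Finset.sum_sub_distrib, hw.sum_eq_one]
    simp only [Finset.sum_ite_eq', Finset.sum_ite_mem, Finset.mem_univ, if_true,
      Finset.univ_inter]
    linarith
  have hterm : ∀ φ ∈ (embeddings (rainbowOf G) χ).filter (fun φ => φ a = u ∧ φ b = v),
      ∏ c, w (φ c) = (k * w u) * (k * w v) * ∏ c, w' (φ c) := by
    intro φ hφ
    rw [Finset.mem_filter, mem_embeddings] at hφ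
    obtain ⟨⟨hinj, hcol⟩, rfl, rfl⟩ := hφ
    have hprod : (k * w (φ a)) * (k * w (φ b)) =
        ∏ c, ((if c = a then k * w (φ a) else 1) * (if c = b then k * w (φ b) else 1)) := by
      rw [Finset.prod_mul_distrib, Finset.prod_ite_eq', Finset.prod_ite_eq']
      simp
    rw [hprod, ← Finset.prod_mul_distrib]
    refine Finset.prod_congr rfl fun c _ => ?_
    simp only [hw', hinj.eq_iff]
    by_cases hca : c = a
    · subst hca
      simp only [hab, true_or, if_true, if_false]
      field_simp
    by_cases hcb : c = b
    · subst hcb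
      simp only [hca, or_true, if_true, if_false]
      field_simp
    have hcS : φ c ∉ S := by
      intro h
      obtain ⟨-, d, -, hda, hd⟩ := mem_roleNbhd.1 h
      rw [hcol a c (Ne.symm hca)] at hd
      have h2 := (rainbowOf_eq_pair hd).2
      have : a ∈ ({r (φ a), d} : Finset (Fin k)) := h2 ▸ by simp
      simp only [Finset.mem_insert, Finset.mem_singleton] at this
      rcases this with h | h
      · exact hu h.symm
      · exact hda h.symm
    simp [hca, hcb, hcS]
  rw [Finset.sum_congr rfl hterm, ← Finset.mul_sum]
  have hsum0 : 0 ≤ ∑ y, w' y := Finset.sum_nonneg fun y _ => hw'0 y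
  have h1 : (∑ y, w' y) ^ k ≤ Real.exp (2 - 10 * Real.log k) := by
    refine (pow_le_pow_left₀ hsum0 hsum k).trans ?_
    refine (one_add_pow_le_exp (hsum0.trans hsum) k).trans (Real.exp_le_exp.2 (le_of_eq ?_))
    field_simp
  have h2 := (hw.sum_le (Finset.filter_subset (fun φ => φ a = u ∧ φ b = v) _) w' hw'0).trans
    (mul_le_mul_of_nonneg_left h1 hP0)
  have h3 : Real.exp (2 - 8 * Real.log k) = k * k * Real.exp (2 - 10 * Real.log k) := by
    nth_rewrite 2 3 [← Real.exp_log hk0]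
    rw [← Real.exp_add, ← Real.exp_add]
    congr 1
    ring
  have hv0 := hw.nonneg v
  refine (mul_le_mul_of_nonneg_left h2 (by positivity)).trans (le_of_eq ?_)
  rw [h3]
  ring

end Roles

section UpperBound

variable {V : Type} [Fintype V] {k : ℕ} {G : SimpleGraph (Fin k)}
  {χ : V → V → Finset (Fin k)} {w : V → ℝ} {r : V → Fin k}

/-- The copies in which some vertex plays a wrong role and is `Z`-related to another vertex of
the copy have weight negligible compared to the weight of `Z`. -/
lemma IsOptimal.sum_misplaced_le (hw : IsOptimal (rainbowOf G) χ w) (hk : 2 ≤ k)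
    (hr : IsRoleMap G χ w r) (Z : V → V → Prop) :
    ∑ φ ∈ (embeddings (rainbowOf G) χ).filter
        (fun φ => ∃ a b, a ≠ b ∧ r (φ a) ≠ a ∧ Z (φ a) (φ b)), ∏ c, w (φ c) ≤
      copyWeight (rainbowOf G) χ w * Real.exp (2 - 6 * Real.log k) *
        ∑ u, ∑ v, if Z u v then w u * w v else 0 := by
  set P := copyWeight (rainbowOf G) χ w
  set E := embeddings (rainbowOf G) χ
  set F := ∑ u, ∑ v, if Z u v then w u * w v else 0
  have hP0 : 0 ≤ P := copyWeight_nonneg _ χ hw.nonneg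
  have hk0 : (0 : ℝ) < k := by exact_mod_cast (by omega : 0 < k)
  have hprod : ∀ φ : Fin k → V, 0 ≤ ∏ c, w (φ c) :=
    fun φ => Finset.prod_nonneg fun c _ => hw.nonneg _
  set f : Fin k → Fin k → (Fin k → V) → ℝ := fun a b φ =>
    if a ≠ b ∧ r (φ a) ≠ a ∧ Z (φ a) (φ b) then ∏ c, w (φ c) else 0 with hf
  have hf0 : ∀ a b φ, 0 ≤ f a b φ := fun a b φ => by
    simp only [hf]
    split_ifs
    exacts [hprod φ, le_rfl]
  have hpair : ∀ a b, ∑ φ ∈ E, f a b φ ≤ P * Real.exp (2 - 8 * Real.log k) * F := by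
    intro a b
    rw [← Finset.sum_fiberwise E (fun φ => (φ a, φ b)) (f a b), Fintype.sum_prod_type,
      Finset.mul_sum]
    refine Finset.sum_le_sum fun u _ => ?_
    rw [Finset.mul_sum]
    refine Finset.sum_le_sum fun v _ => ?_
    simp only [Prod.mk.injEq]
    by_cases h : a ≠ b ∧ r u ≠ a ∧ Z u v
    · rw [if_pos h.2.2]
      refine le_trans (Finset.sum_le_sum fun φ _ => ?_) (hw.sum_pair_le hk hr h.1 h.2.1)
      simp only [hf]
      split_ifs
      exacts [le_rfl, hprod φ]
    · refine le_trans (Finset.sum_eq_zero fun φ hφ => ?_).le ?_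
      · obtain ⟨-, rfl, rfl⟩ := Finset.mem_filter.1 hφ
        exact if_neg h
      · have := mul_nonneg (hw.nonneg u) (hw.nonneg v)
        split_ifs <;> positivity
  have hle : ∑ φ ∈ E.filter (fun φ => ∃ a b, a ≠ b ∧ r (φ a) ≠ a ∧ Z (φ a) (φ b)),
      ∏ c, w (φ c) ≤ ∑ a, ∑ b, ∑ φ ∈ E, f a b φ := by
    have hcomm : ∑ a, ∑ b, ∑ φ ∈ E, f a b φ = ∑ φ ∈ E, ∑ a, ∑ b, f a b φ := by
      simp only [Finset.sum_comm (t := E)]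
    rw [hcomm, Finset.sum_filter]
    refine Finset.sum_le_sum fun φ _ => ?_
    split_ifs with h
    · obtain ⟨a, b, hab⟩ := h
      calc ∏ c, w (φ c) = f a b φ := (if_pos hab).symm
        _ ≤ ∑ b, f a b φ :=
          Finset.single_le_sum (fun b _ => hf0 a b φ) (Finset.mem_univ b)
        _ ≤ ∑ a, ∑ b, f a b φ :=
          Finset.single_le_sum (f := fun a => ∑ b, f a b φ)
            (fun a _ => Finset.sum_nonneg fun b _ => hf0 a b φ) (Finset.mem_univ a)
    · exact Finset.sum_nonneg fun a _ => Finset.sum_nonneg fun b _ => hf0 a b φ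
  refine hle.trans ((Finset.sum_le_sum fun a _ => Finset.sum_le_sum fun b _ =>
    hpair a b).trans (le_of_eq ?_))
  have h3 : Real.exp (2 - 6 * Real.log k) = k * k * Real.exp (2 - 8 * Real.log k) := by
    nth_rewrite 2 3 [← Real.exp_log hk0]
    rw [← Real.exp_add, ← Real.exp_add]
    congr 1
    ring
  rw [h3]
  simp only [Finset.sum_const, Finset.card_univ, Fintype.card_fin, nsmul_eq_mul]
  ring

/-- The pairs of vertices with different roles whose color is not the one prescribed by
their roles. -/
def IsFunky (G : SimpleGraph (Fin k)) (χ : V → V → Finset (Fin k)) (r : V → Fin k)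
    (u v : V) : Prop :=
  r u ≠ r v ∧ χ u v ≠ rainbowOf G (r u) (r v)

/-- The tuples choosing for every role a vertex with this role. -/
noncomputable def transversals (r : V → Fin k) : Finset (Fin k → V) :=
  Fintype.piFinset fun c => Finset.univ.filter fun x => r x = c

lemma mem_transversals {ψ : Fin k → V} : ψ ∈ transversals r ↔ ∀ c, r (ψ c) = c := by
  simp [transversals]

lemma sum_transversals (r : V → Fin k) (w : V → ℝ) :
    ∑ ψ ∈ transversals r, ∏ c, w (ψ c) = ∏ c, ∑ x with r x = c, w x :=
  (Finset.prod_univ_sum _ _).symm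

lemma sum_fiber_le_one (hw0 : ∀ x, 0 ≤ w x) (hw1 : ∑ x, w x = 1) (c : Fin k) :
    ∑ x with r x = c, w x ≤ 1 := by
  rw [← hw1]
  exact Finset.sum_le_sum_of_subset_of_nonneg (Finset.subset_univ _) fun x _ _ => hw0 x

lemma mul_prod_le_sum_transversals (hw0 : ∀ x, 0 ≤ w x) (hw1 : ∑ x, w x = 1) {u v : V}
    (huv : r u ≠ r v) :
    w u * w v * ∏ c, ∑ x with r x = c, w x ≤
      ∑ ψ ∈ (transversals r).filter (fun ψ => ψ (r u) = u ∧ ψ (r v) = v), ∏ c, w (ψ c) := by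
  set B : Fin k → Finset V := fun c => if c = r u then {u} else if c = r v then {v} else
    Finset.univ.filter fun x => r x = c with hB
  have hfilter : (transversals r).filter (fun ψ => ψ (r u) = u ∧ ψ (r v) = v) =
      Fintype.piFinset B := by
    ext ψ
    rw [Finset.mem_filter, mem_transversals, Fintype.mem_piFinset]
    constructor
    · rintro ⟨h, hu, hv⟩ c
      simp only [hB]
      split_ifs with h1 h2
      · rw [h1, hu]; simp
      · rw [h2, hv]; simp
      · simpa using h c
    · intro h
      have hu : ψ (r u) = u := by simpa [hB] using h (r u)
      have hv : ψ (r v) = v := by simpa [hB, huv.symm] using h (r v)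
      refine ⟨fun c => ?_, hu, hv⟩
      by_cases h1 : c = r u
      · rw [h1, hu]
      by_cases h2 : c = r v
      · rw [h2, hv]
      simpa [hB, h1, h2] using h c
  rw [hfilter, ← Finset.prod_univ_sum]
  have hprod : w u * w v =
      ∏ c, ((if c = r u then w u else 1) * (if c = r v then w v else 1)) := by
    rw [Finset.prod_mul_distrib, Finset.prod_ite_eq', Finset.prod_ite_eq']
    simp
  have hW0 : ∀ c, 0 ≤ ∑ x with r x = c, w x := fun c => Finset.sum_nonneg fun x _ => hw0 x
  rw [hprod, ← Finset.prod_mul_distrib]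
  refine Finset.prod_le_prod (fun c _ => mul_nonneg ?_ (hW0 c)) fun c _ => ?_
  · have hu := hw0 u
    have hv := hw0 v
    split_ifs <;> positivity
  · have h1 := sum_fiber_le_one (r := r) hw0 hw1 c
    by_cases hcu : c = r u
    · have hcv : c ≠ r v := hcu ▸ huv
      simp only [hB, if_pos hcu, if_neg hcv, Finset.sum_singleton, mul_one]
      exact mul_le_of_le_one_right (hw0 u) h1
    by_cases hcv : c = r v
    · simp only [hB, if_neg hcu, if_pos hcv, Finset.sum_singleton, one_mul]
      exact mul_le_of_le_one_right (hw0 v) h1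
    · simp only [hB, if_neg hcu, if_neg hcv, one_mul]
      exact le_rfl

/-- Funky pairs destroy a proportional amount of transversal copies. -/
lemma sum_funky_mul_prod_le (hw0 : ∀ x, 0 ≤ w x) (hw1 : ∑ x, w x = 1) :
    (∑ u, ∑ v, if IsFunky G χ r u v then w u * w v else 0) *
        ∏ c, ∑ x with r x = c, w x ≤
      (k : ℝ) ^ 2 * ∑ ψ ∈ (transversals r).filter (fun ψ => ψ ∉ embeddings (rainbowOf G) χ),
        ∏ c, w (ψ c) := by
  set L := (transversals r).filter (fun ψ => ψ ∉ embeddings (rainbowOf G) χ) with hL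
  have hprod : ∀ φ : Fin k → V, 0 ≤ ∏ c, w (φ c) :=
    fun φ => Finset.prod_nonneg fun c _ => hw0 _
  have hpair : ∀ u v, (if IsFunky G χ r u v then w u * w v else 0) *
      ∏ c, ∑ x with r x = c, w x ≤
      ∑ ψ ∈ L, if ψ (r u) = u ∧ ψ (r v) = v then ∏ c, w (ψ c) else 0 := by
    intro u v
    split_ifs with h
    · refine (mul_prod_le_sum_transversals hw0 hw1 h.1).trans ?_
      rw [← Finset.sum_filter]
      refine Finset.sum_le_sum_of_subset_of_nonneg (fun ψ hψ => ?_) fun ψ _ _ => hprod ψ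
      rw [Finset.mem_filter] at hψ
      refine Finset.mem_filter.2 ⟨Finset.mem_filter.2 ⟨hψ.1, fun hE => h.2 ?_⟩, hψ.2⟩
      have := (mem_embeddings.1 hE).2 (r u) (r v) h.1
      rwa [hψ.2.1, hψ.2.2] at this
    · rw [zero_mul]
      exact Finset.sum_nonneg fun ψ _ => by
        split_ifs
        exacts [hprod ψ, le_rfl]
  have hcount : ∀ ψ : Fin k → V,
      ∑ u, ∑ v, (if ψ (r u) = u ∧ ψ (r v) = v then ∏ c, w (ψ c) else 0) ≤
        (k : ℝ) ^ 2 * ∏ c, w (ψ c) := by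
    intro ψ
    set U : Finset V := Finset.univ.filter fun u => ψ (r u) = u with hU
    have hcard : U.card ≤ k := by
      have : U.card ≤ (Finset.univ : Finset (Fin k)).card := by
        refine Finset.card_le_card_of_injOn r (fun _ _ => Finset.mem_coe.2 (Finset.mem_univ _)) ?_
        intro u hu v hv huv
        simp only [hU, Finset.coe_filter, Finset.mem_univ, true_and, Set.mem_ofPred_eq] at hu hv
        rw [← hu, ← hv, huv]
      simpa using this
    have hsum : ∑ u, ∑ v, (if ψ (r u) = u ∧ ψ (r v) = v then ∏ c, w (ψ c) else 0) =
        (U.card : ℝ) ^ 2 * ∏ c, w (ψ c) := by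
      simp only [ite_and, Finset.sum_ite_irrel, ← Finset.sum_filter, Finset.sum_const_zero]
      simp only [← hU, Finset.sum_const, nsmul_eq_mul]
      ring
    rw [hsum]
    have : (U.card : ℝ) ≤ k := by exact_mod_cast hcard
    exact mul_le_mul_of_nonneg_right (pow_le_pow_left₀ (by positivity) this 2) (hprod ψ)
  calc _ = ∑ u, ∑ v, (if IsFunky G χ r u v then w u * w v else 0) *
        ∏ c, ∑ x with r x = c, w x := by
        simp only [Finset.sum_mul]
    _ ≤ ∑ u, ∑ v, ∑ ψ ∈ L, if ψ (r u) = u ∧ ψ (r v) = v then ∏ c, w (ψ c) else 0 :=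
        Finset.sum_le_sum fun u _ => Finset.sum_le_sum fun v _ => hpair u v
    _ = ∑ ψ ∈ L, ∑ u, ∑ v, if ψ (r u) = u ∧ ψ (r v) = v then ∏ c, w (ψ c) else 0 := by
        simp only [Finset.sum_comm (t := L)]
    _ ≤ ∑ ψ ∈ L, (k : ℝ) ^ 2 * ∏ c, w (ψ c) := Finset.sum_le_sum fun ψ _ => hcount ψ
    _ = _ := by rw [Finset.mul_sum]


lemma two_mul_sq_mul_exp_le_one (hk : 2 ≤ k) :
    2 * ((k : ℝ) ^ 2 * Real.exp (2 - 6 * Real.log k)) ≤ 1 := by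
  have hk0 : (0 : ℝ) < k := by exact_mod_cast (by omega : 0 < k)
  have h2 : Real.log 2 ≤ Real.log k :=
    Real.log_le_log (by norm_num) (by exact_mod_cast hk)
  have h : 2 * ((k : ℝ) ^ 2 * Real.exp (2 - 6 * Real.log k)) =
      Real.exp (Real.log 2 + (2 * Real.log k + (2 - 6 * Real.log k))) := by
    rw [Real.exp_add, Real.exp_add (2 * Real.log k), Real.exp_log two_pos,
      show 2 * Real.log k = ((2 : ℕ) : ℝ) * Real.log k by norm_num, Real.exp_nat_mul,
      Real.exp_log hk0]
  rw [h, Real.exp_le_one_iff]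
  linarith [Real.log_two_gt_d9]

lemma exists_adj_ne (hk : 2 ≤ k) (hdeg : ∀ i, 40 * Real.log k ≤ degR G i) (i j : Fin k) :
    ∃ c, G.Adj i c ∧ c ≠ j := by
  have h1 := degR_le_card_erase_add_one G i j
  have h2 : 1 < degR G i := by
    have h3 := half_lt_log hk
    have h4 : (1 : ℝ) < degR G i := by linarith [hdeg i]
    exact_mod_cast h4
  obtain ⟨c, hc⟩ := Finset.card_pos.1 (by omega :
    0 < (Finset.univ.filter fun c => G.Adj i c ∧ c ≠ j).card)
  exact ⟨c, by simpa using hc⟩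

/-- A copy is transversal, lies inside a single part, or contains a funky pair one of whose
vertices plays a wrong role. -/
lemma embedding_trichotomy (hG : G.Connected) (hadj : ∀ i j, ∃ c, G.Adj i c ∧ c ≠ j)
    {φ : Fin k → V} (hφ : φ ∈ embeddings (rainbowOf G) χ) :
    φ ∈ transversals r ∨ (∃ c, ∀ a, r (φ a) = c) ∨
      ∃ a b, a ≠ b ∧ r (φ a) ≠ a ∧ IsFunky G χ r (φ a) (φ b) := by
  by_cases hf : ∀ a b, r (φ a) ≠ r (φ b) → rainbowOf G a b = rainbowOf G (r (φ a)) (r (φ b))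
  · rcases rainbowOf_rigid hG hadj (fun a => r (φ a)) hf with h | h
    · obtain ⟨c⟩ := hG.nonempty
      exact Or.inr (Or.inl ⟨r (φ c), fun a => h a c⟩)
    · exact Or.inl (mem_transversals.2 h)
  · push Not at hf
    obtain ⟨a, b, hab, hne⟩ := hf
    have hab' : a ≠ b := fun h => hab (by rw [h])
    have hcol := (mem_embeddings.1 hφ).2
    by_cases ha : r (φ a) = a
    · have hb : r (φ b) ≠ b := fun hb => hne (by rw [ha, hb])
      refine Or.inr (Or.inr ⟨b, a, hab'.symm, hb, hab.symm, ?_⟩)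
      rwa [hcol b a hab'.symm, rainbowOf_comm, rainbowOf_comm G (r (φ b))]
    · exact Or.inr (Or.inr ⟨a, b, hab', ha, hab, by rwa [hcol a b hab']⟩)

lemma IsOptimal.copyWeight_le_two_mul_prod (hw : IsOptimal (rainbowOf G) χ w) (hk : 2 ≤ k)
    (hr : IsRoleMap G χ w r) :
    copyWeight (rainbowOf G) χ w ≤ 2 * ∏ c, ∑ x with r x = c, w x := by
  set P := copyWeight (rainbowOf G) χ w with hP
  have hP0 : 0 ≤ P := copyWeight_nonneg _ χ hw.nonneg
  have hprod : ∀ φ : Fin k → V, 0 ≤ ∏ c, w (φ c) :=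
    fun φ => Finset.prod_nonneg fun c _ => hw.nonneg _
  have hmis := hw.sum_misplaced_le hk hr fun _ _ => True
  simp only [and_true, if_true, ← Finset.mul_sum, hw.sum_eq_one,
    mul_one] at hmis
  set M := (embeddings (rainbowOf G) χ).filter fun φ => ∃ a b, a ≠ b ∧ r (φ a) ≠ a with hM
  have hsub : embeddings (rainbowOf G) χ ⊆ transversals r ∪ M := by
    intro φ hφ
    rw [Finset.mem_union, mem_transversals]
    by_cases h : ∀ c, r (φ c) = c
    · exact Or.inl h
    · push Not at h
      obtain ⟨a, ha⟩ := h
      have : Nontrivial (Fin k) := Fin.nontrivial_iff_two_le.2 hk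
      obtain ⟨b, hb⟩ := exists_ne a
      exact Or.inr (Finset.mem_filter.2 ⟨hφ, a, b, hb.symm, ha⟩)
  have h1 : P ≤ ∏ c, ∑ x with r x = c, w x + ∑ φ ∈ M, ∏ c, w (φ c) := by
    rw [← sum_transversals, ← Finset.sum_union_inter]
    exact (Finset.sum_le_sum_of_subset_of_nonneg hsub fun φ _ _ => hprod φ).trans
      (le_add_of_nonneg_right (Finset.sum_nonneg fun φ _ => hprod φ))
  have hexp : Real.exp (2 - 6 * Real.log k) ≤ 1 / 2 := by
    have h2 := two_mul_sq_mul_exp_le_one hk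
    have hk1 : (1 : ℝ) ≤ (k : ℝ) ^ 2 := one_le_pow₀ (by exact_mod_cast (by omega : 1 ≤ k))
    have := mul_le_mul_of_nonneg_right hk1 (Real.exp_pos (2 - 6 * Real.log k)).le
    linarith
  have := mul_le_mul_of_nonneg_left hexp hP0
  linarith

/-- The copies lying inside parts and the transversal copies account for everything. -/
lemma IsOptimal.copyWeight_le_prod_add (hw : IsOptimal (rainbowOf G) χ w) (hk : 2 ≤ k)
    (hG : G.Connected) (hadj : ∀ i j, ∃ c, G.Adj i c ∧ c ≠ j) (hr : IsRoleMap G χ w r) :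
    copyWeight (rainbowOf G) χ w ≤ ∏ c, ∑ x with r x = c, w x +
      copyWeight (rainbowOf G) χ w * ∑ c, (∑ x with r x = c, w x) ^ k := by
  set E := embeddings (rainbowOf G) χ
  set P := copyWeight (rainbowOf G) χ w with hP
  set Q := ∏ c, ∑ x with r x = c, w x with hQ
  have hprod : ∀ φ : Fin k → V, 0 ≤ ∏ c, w (φ c) :=
    fun φ => Finset.prod_nonneg fun c _ => hw.nonneg _
  have hinside : ∀ c, ∑ φ ∈ E.filter (fun φ => ∀ a, r (φ a) = c), ∏ a, w (φ a) ≤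
      P * (∑ x with r x = c, w x) ^ k := by
    intro c
    have h := hw.sum_le (Finset.filter_subset (fun φ => ∀ a, r (φ a) = c) E)
      (fun x => if r x = c then w x else 0)
      (fun x => by
        have := hw.nonneg x
        split_ifs <;> linarith)
    rw [← Finset.sum_filter] at h
    refine le_trans (Finset.sum_congr rfl fun φ hφ => ?_).le h
    exact Finset.prod_congr rfl fun a _ => (if_pos ((Finset.mem_filter.1 hφ).2 a)).symm
  have hbad := hw.sum_misplaced_le hk hr (IsFunky G χ r)
  set F := ∑ u, ∑ v, if IsFunky G χ r u v then w u * w v else 0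
  set B := E.filter fun φ => ∃ a b, a ≠ b ∧ r (φ a) ≠ a ∧ IsFunky G χ r (φ a) (φ b) with hB
  have hlost := sum_funky_mul_prod_le (G := G) (χ := χ) (r := r) hw.nonneg hw.sum_eq_one
  set L := ∑ ψ ∈ (transversals r).filter (fun ψ => ψ ∉ E), ∏ c, w (ψ c) with hL
  have hL0 : 0 ≤ L := Finset.sum_nonneg fun ψ _ => hprod ψ
  have hF0 : 0 ≤ F := Finset.sum_nonneg fun u _ => Finset.sum_nonneg fun v _ => by
    have := mul_nonneg (hw.nonneg u) (hw.nonneg v)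
    split_ifs <;> linarith
  have htrans : ∑ ψ ∈ (transversals r).filter (fun ψ => ψ ∈ E), ∏ c, w (ψ c) = Q - L := by
    rw [hQ, ← sum_transversals, hL,
      ← Finset.sum_filter_add_sum_filter_not (transversals r) (fun ψ => ψ ∈ E)]
    ring
  have hbadL : ∑ φ ∈ B, ∏ c, w (φ c) ≤ L := by
    set e := Real.exp (2 - 6 * Real.log k)
    have he : 0 ≤ e := (Real.exp_pos _).le
    calc _ ≤ P * e * F := hbad
      _ = P * (e * F) := by ring
      _ ≤ 2 * Q * (e * F) := mul_le_mul_of_nonneg_right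
          (hw.copyWeight_le_two_mul_prod hk hr) (mul_nonneg he hF0)
      _ = 2 * e * (F * Q) := by ring
      _ ≤ 2 * e * ((k : ℝ) ^ 2 * L) := mul_le_mul_of_nonneg_left hlost (by positivity)
      _ = 2 * ((k : ℝ) ^ 2 * e) * L := by ring
      _ ≤ 1 * L := mul_le_mul_of_nonneg_right (two_mul_sq_mul_exp_le_one hk) hL0
      _ = L := one_mul L
  have hsub : E ⊆ ((transversals r).filter (fun ψ => ψ ∈ E) ∪
      Finset.univ.biUnion fun c => E.filter fun φ => ∀ a, r (φ a) = c) ∪ B := by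
    intro φ hφ
    simp only [Finset.mem_union, Finset.mem_biUnion, Finset.mem_filter, Finset.mem_univ,
      true_and, hB]
    rcases embedding_trichotomy (r := r) hG hadj hφ with h | ⟨c, h⟩ | h
    · exact Or.inl (Or.inl ⟨h, hφ⟩)
    · exact Or.inl (Or.inr ⟨c, hφ, h⟩)
    · exact Or.inr ⟨hφ, h⟩
  have hunion : ∀ s t : Finset (Fin k → V), ∑ φ ∈ s ∪ t, ∏ a, w (φ a) ≤
      ∑ φ ∈ s, ∏ a, w (φ a) + ∑ φ ∈ t, ∏ a, w (φ a) := fun s t => by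
    rw [← Finset.sum_union_inter]
    exact le_add_of_nonneg_right (Finset.sum_nonneg fun φ _ => hprod φ)
  have hbi : ∑ φ ∈ Finset.univ.biUnion (fun c => E.filter fun φ => ∀ a, r (φ a) = c),
      ∏ a, w (φ a) ≤ P * ∑ c, (∑ x with r x = c, w x) ^ k := by
    rw [Finset.mul_sum]
    have hdisj : Set.PairwiseDisjoint (Finset.univ : Finset (Fin k))
        fun c => E.filter fun φ => ∀ a, r (φ a) = c := by
      intro c _ d _ hcd
      refine Finset.disjoint_left.2 fun φ hc hd => hcd ?_
      rw [← (Finset.mem_filter.1 hc).2 c, (Finset.mem_filter.1 hd).2 c]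
    rw [Finset.sum_biUnion hdisj]
    exact Finset.sum_le_sum fun c _ => hinside c
  have htotal : P ≤ _ :=
    (Finset.sum_le_sum_of_subset_of_nonneg hsub fun φ _ _ => hprod φ).trans (hunion _ _)
  have := hunion ((transversals r).filter (fun ψ => ψ ∈ E))
    (Finset.univ.biUnion fun c => E.filter fun φ => ∀ a, r (φ a) = c)
  linarith

lemma self_lt_pow_self_real (hk : 2 ≤ k) : (k : ℝ) < (k : ℝ) ^ k := by
  have h1 : (1 : ℝ) < k := by exact_mod_cast (by omega : 1 < k)
  simpa using pow_lt_pow_right₀ h1 (by omega : 1 < k)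

lemma IsOptimal.copyWeight_le_inv (hw : IsOptimal (rainbowOf G) χ w) (hk : 2 ≤ k)
    (hG : G.Connected) (hdeg : ∀ i, 40 * Real.log k ≤ degR G i) :
    copyWeight (rainbowOf G) χ w ≤ 1 / ((k : ℝ) ^ k - k) := by
  have hD : 0 < (k : ℝ) ^ k - k := sub_pos.2 (self_lt_pow_self_real hk)
  rcases (copyWeight_nonneg (rainbowOf G) χ hw.nonneg).eq_or_lt with h0 | hP
  · rw [← h0]
    positivity
  obtain ⟨r, hr⟩ := hw.exists_isRoleMap hk hP hdeg
  have h1 := hw.copyWeight_le_two_mul_prod hk hr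
  have h2 := hw.copyWeight_le_prod_add hk hG (exists_adj_ne hk hdeg) hr
  have h3 := pow_sub_self_mul_prod_le (by omega : 0 < k) (fun c => ∑ x with r x = c, w x)
    fun c => Finset.sum_nonneg fun x _ => hw.nonneg x
  rw [Finset.sum_fiberwise, hw.sum_eq_one, one_pow] at h3
  set P := copyWeight (rainbowOf G) χ w
  set Q := ∏ c, ∑ x with r x = c, w x
  set s := ∑ c, (∑ x with r x = c, w x) ^ k
  have hQ : 0 < Q := by linarith
  rw [le_div_iff₀ hD]
  refine le_of_mul_le_mul_right ?_ hQ
  calc P * ((k : ℝ) ^ k - k) * Q = P * (((k : ℝ) ^ k - k) * Q) := by ring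
    _ ≤ P * (1 - s) := mul_le_mul_of_nonneg_left h3 hP.le
    _ ≤ 1 * Q := by linarith

lemma card_embeddings_le (χ : V → V → Finset (Fin k)) (hk : 2 ≤ k)
    (hG : G.Connected) (hdeg : ∀ i, 40 * Real.log k ≤ degR G i) :
    ((embeddings (rainbowOf G) χ).card : ℝ) ≤
      (Fintype.card V : ℝ) ^ k / ((k : ℝ) ^ k - k) := by
  have hD : 0 < (k : ℝ) ^ k - k := sub_pos.2 (self_lt_pow_self_real hk)
  rcases isEmpty_or_nonempty V with hV | hV
  · have : Nonempty (Fin k) := hG.nonempty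
    have : IsEmpty (Fin k → V) := inferInstance
    rw [Finset.eq_empty_of_isEmpty (embeddings (rainbowOf G) χ), Finset.card_empty,
      Nat.cast_zero]
    positivity
  obtain ⟨w, hw⟩ := exists_isOptimal (by omega : 0 < k) (rainbowOf G) χ
  have h := hw.copyWeight_le (fun _ => 1) fun _ => zero_le_one
  simp only [copyWeight, Finset.prod_const_one, Finset.sum_const, nsmul_eq_mul, mul_one,
    Finset.card_univ] at h
  refine h.trans ?_
  rw [div_eq_mul_one_div, mul_comm]
  exact mul_le_mul_of_nonneg_left (hw.copyWeight_le_inv hk hG hdeg) (by positivity)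

end UpperBound

section CopyCount

variable {T : Type} {k n : ℕ}

lemma copyCount_le_card_embeddings (R : Fin k → Fin k → T) (χ : Fin n → Fin n → T) :
    copyCount k n R χ ≤ (embeddings R χ).card := by
  refine le_trans (Finset.card_le_card fun S hS => ?_)
    (Finset.card_image_le (f := fun φ : Fin k → Fin n => Finset.univ.image φ))
  obtain ⟨hS, φ, hinj, hmem, hcol⟩ := Finset.mem_filter.1 hS
  refine Finset.mem_image.2 ⟨φ, mem_embeddings.2 ⟨hinj, hcol⟩, ?_⟩
  refine Finset.eq_of_subset_of_card_le (Finset.image_subset_iff.2 fun a _ => hmem a) ?_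
  rw [Finset.card_image_of_injective _ hinj, (Finset.mem_powersetCard.1 hS).2,
    Finset.card_univ, Fintype.card_fin]

lemma card_embeddings_le_copyCount_of_injOn {R : Fin k → Fin k → T} {χ : Fin n → Fin n → T}
    (h : ∀ φ ∈ embeddings R χ, ∀ ψ ∈ embeddings R χ,
      Finset.univ.image φ = Finset.univ.image ψ → φ = ψ) :
    (embeddings R χ).card ≤ copyCount k n R χ := by
  refine Finset.card_le_card_of_injOn (fun φ => Finset.univ.image φ) (fun φ hφ => ?_)
    fun φ hφ ψ hψ => h φ (Finset.mem_coe.1 hφ) ψ (Finset.mem_coe.1 hψ)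
  obtain ⟨hinj, hcol⟩ := mem_embeddings.1 (Finset.mem_coe.1 hφ)
  refine Finset.mem_coe.2 (Finset.mem_filter.2 ⟨Finset.mem_powersetCard.2
    ⟨Finset.subset_univ _, ?_⟩, φ, hinj,
    fun a => Finset.mem_image_of_mem φ (Finset.mem_univ a), hcol⟩)
  rw [Finset.card_image_of_injective _ hinj, Finset.card_univ, Fintype.card_fin]

lemma card_embeddings_le_copyCount {G : SimpleGraph (Fin k)} (hk : 2 ≤ k) (hG : G.Connected)
    (hadj : ∀ i j, ∃ c, G.Adj i c ∧ c ≠ j) (χ : Fin n → Fin n → Finset (Fin k)) :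
    (embeddings (rainbowOf G) χ).card ≤ copyCount k n (rainbowOf G) χ := by
  refine card_embeddings_le_copyCount_of_injOn fun φ hφ ψ hψ h => ?_
  obtain ⟨hφinj, hφcol⟩ := mem_embeddings.1 hφ
  obtain ⟨-, hψcol⟩ := mem_embeddings.1 hψ
  have hex : ∀ a, ∃ b, ψ b = φ a := fun a => by
    have : φ a ∈ Finset.univ.image ψ := h ▸ Finset.mem_image_of_mem φ (Finset.mem_univ a)
    simpa using this
  choose f hf using hex
  have hrigid := rainbowOf_rigid hG hadj f fun a b hab => by
    rw [← hψcol _ _ hab, hf, hf, hφcol]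
    rintro rfl
    exact hab rfl
  rcases hrigid with hconst | hid
  · have : Nontrivial (Fin k) := Fin.nontrivial_iff_two_le.2 hk
    obtain ⟨a, b, hab⟩ := exists_pair_ne (Fin k)
    exact absurd (hφinj (by rw [← hf, ← hf, hconst a b])) hab
  · exact funext fun a => by rw [← hf, hid]

end CopyCount

section LowerBound

variable {k : ℕ} [NeZero k]

/-- The balanced nested coloring of depth `L`: at every level the vertices are split into `k`
classes by their last base-`k` digit, and pairs in different classes are colored by `R`. -/
def nestedColoring (R : Fin k → Fin k → Finset (Fin k)) : ℕ → ℕ → ℕ → Finset (Fin k)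
  | 0, _, _ => ∅
  | L + 1, u, v =>
    if Fin.ofNat k u = Fin.ofNat k v then nestedColoring R L (u / k) (v / k)
    else R (Fin.ofNat k u) (Fin.ofNat k v)

lemma nestedColoring_comm {R : Fin k → Fin k → Finset (Fin k)} (hR : ∀ a b, R a b = R b a)
    (L u v : ℕ) : nestedColoring R L u v = nestedColoring R L v u := by
  induction L generalizing u v with
  | zero => rfl
  | succ L ih => simp only [nestedColoring, eq_comm (a := Fin.ofNat k u), ih (u / k), hR _
      (Fin.ofNat k v)]

/-- The vertex with last base-`k` digit `p` and remaining digits given by `q`. -/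
def place {n : ℕ} (p : Fin k) (q : Fin (n / k)) : Fin n :=
  ⟨p + k * q, by
    have h1 : k * (q + 1) ≤ k * (n / k) := Nat.mul_le_mul_left k q.2
    have h2 : k * (n / k) ≤ n := Nat.mul_div_le n k
    have h3 := p.2
    rw [mul_add] at h1
    omega⟩

lemma ofNat_place {n : ℕ} (p : Fin k) (q : Fin (n / k)) :
    Fin.ofNat k (place p q : Fin n) = p := by
  ext
  simp [place, Nat.mod_eq_of_lt p.2]

lemma place_div {n : ℕ} (p : Fin k) (q : Fin (n / k)) :
    ((place p q : Fin n) : ℕ) / k = q := by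
  simp [place, Nat.add_mul_div_left, NeZero.pos k, Nat.div_eq_of_lt p.2]

lemma place_inj {n : ℕ} {p p' : Fin k} {q q' : Fin (n / k)}
    (h : (place p q : Fin n) = place p' q') : p = p' ∧ q = q' := by
  refine ⟨by rw [← ofNat_place p q, h, ofNat_place], Fin.ext ?_⟩
  rw [← place_div p q, h, place_div]

lemma card_embeddings_nestedColoring_succ (hk : 2 ≤ k) (R : Fin k → Fin k → Finset (Fin k))
    (L n : ℕ) :
    (n / k) ^ k + k * (embeddings R fun u v : Fin (n / k) => nestedColoring R L u v).card ≤
      (embeddings R fun u v : Fin n => nestedColoring R (L + 1) u v).card := by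
  set E := embeddings R fun u v : Fin (n / k) => nestedColoring R L u v
  set A : Finset (Fin k → Fin n) :=
    (Finset.univ : Finset (Fin k → Fin (n / k))).image fun q a => place a (q a) with hA
  set B : Finset (Fin k → Fin n) :=
    ((Finset.univ : Finset (Fin k)) ×ˢ E).image fun x a => place x.1 (x.2 a) with hB
  have hAcard : A.card = (n / k) ^ k := by
    rw [hA, Finset.card_image_of_injective]
    · simp
    · exact fun q q' h => funext fun a => (place_inj (congrFun h a)).2
  have hBcard : B.card = k * E.card := by
    rw [hB, Finset.card_image_of_injective]
    · simp [Finset.card_product]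
    · exact fun x x' h => Prod.ext (place_inj (congrFun h 0)).1
        (funext fun a => (place_inj (congrFun h a)).2)
  have hdisj : Disjoint A B := by
    refine Finset.disjoint_left.2 fun φ hφA hφB => ?_
    obtain ⟨q, -, rfl⟩ := Finset.mem_image.1 hφA
    obtain ⟨x, -, h⟩ := Finset.mem_image.1 hφB
    have : Nontrivial (Fin k) := Fin.nontrivial_iff_two_le.2 hk
    obtain ⟨a, ha⟩ := exists_ne x.1
    exact ha (place_inj (congrFun h a)).1.symm
  rw [← hAcard, ← hBcard, ← Finset.card_union_of_disjoint hdisj]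
  refine Finset.card_le_card (Finset.union_subset (fun φ hφ => ?_) fun φ hφ => ?_)
  · obtain ⟨q, -, rfl⟩ := Finset.mem_image.1 hφ
    refine mem_embeddings.2 ⟨fun a b h => (place_inj h).1, fun a b hab => ?_⟩
    simp only [nestedColoring, ofNat_place, if_neg hab]
  · obtain ⟨x, hx, rfl⟩ := Finset.mem_image.1 hφ
    obtain ⟨hinj, hcol⟩ := mem_embeddings.1 (Finset.mem_product.1 hx).2
    refine mem_embeddings.2 ⟨fun a b h => hinj (place_inj h).2, fun a b hab => ?_⟩
    simp only [nestedColoring, ofNat_place, if_true, place_div]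
    exact hcol a b hab

lemma sum_le_card_embeddings_nestedColoring (hk : 2 ≤ k)
    (R : Fin k → Fin k → Finset (Fin k)) (L n : ℕ) :
    ∑ l ∈ Finset.range L, k ^ l * (n / k ^ (l + 1)) ^ k ≤
      (embeddings R fun u v : Fin n => nestedColoring R L u v).card := by
  induction L generalizing n with
  | zero => simp
  | succ L ih =>
    refine le_trans ?_ (card_embeddings_nestedColoring_succ hk R L n)
    have := Nat.mul_le_mul_left k (ih (n / k))
    rw [Finset.sum_range_succ', Finset.mul_sum] at *
    simp only [Nat.div_div_eq_div_mul, ← mul_assoc, ← pow_succ'] at this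
    simp only [pow_zero, one_mul, zero_add, pow_one]
    omega

end LowerBound

section Limit

variable {k : ℕ} {G : SimpleGraph (Fin k)}

lemma maxCopyCount_le (hk : 2 ≤ k) (hG : G.Connected)
    (hdeg : ∀ i, 40 * Real.log k ≤ degR G i) (n : ℕ) :
    (maxCopyCount k n (rainbowOf G) : ℝ) ≤ (n : ℝ) ^ k / ((k : ℝ) ^ k - k) := by
  have hne : ((Finset.univ : Finset (Fin n → Fin n → Finset (Fin k))).filter
      fun χ => IsSym χ).Nonempty :=
    ⟨fun _ _ => ∅, Finset.mem_filter.2 ⟨Finset.mem_univ _, fun _ _ => rfl⟩⟩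
  obtain ⟨χ, -, hχ⟩ := Finset.exists_mem_eq_sup _ hne fun χ => copyCount k n (rainbowOf G) χ
  rw [maxCopyCount, hχ]
  have h := card_embeddings_le χ hk hG hdeg
  rw [Fintype.card_fin] at h
  exact (Nat.cast_le.2 (copyCount_le_card_embeddings (rainbowOf G) χ)).trans h

lemma le_maxCopyCount (hk : 2 ≤ k) (hG : G.Connected)
    (hadj : ∀ i j, ∃ c, G.Adj i c ∧ c ≠ j) (L n : ℕ) :
    ∑ l ∈ Finset.range L, k ^ l * (n / k ^ (l + 1)) ^ k ≤ maxCopyCount k n (rainbowOf G) := by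
  have : NeZero k := ⟨by omega⟩
  refine (sum_le_card_embeddings_nestedColoring hk (rainbowOf G) L n).trans
    ((card_embeddings_le_copyCount hk hG hadj _).trans ?_)
  exact Finset.le_sup (f := fun χ => copyCount k n (rainbowOf G) χ) (Finset.mem_filter.2
    ⟨Finset.mem_univ _, fun u v => nestedColoring_comm (rainbowOf_comm G) L u v⟩)

lemma tendsto_pow_div_choose (k : ℕ) :
    Tendsto (fun n : ℕ => (n : ℝ) ^ k / (n.choose k : ℝ)) atTop (nhds (k.factorial : ℝ)) := by
  have hne : ∀ᶠ n : ℕ in atTop, (n.choose k : ℝ) ≠ 0 := by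
    filter_upwards [eventually_ge_atTop k] with n hn
    exact_mod_cast (Nat.choose_pos hn).ne'
  have h := (Asymptotics.isEquivalent_iff_tendsto_one hne).1 (isEquivalent_choose k).symm
  have h' := h.const_mul (k.factorial : ℝ)
  rw [mul_one] at h'
  refine h'.congr fun n => ?_
  have : (k.factorial : ℝ) ≠ 0 := by exact_mod_cast k.factorial_ne_zero
  simp only [Pi.div_apply]
  field_simp

lemma tendsto_nat_div_div {m : ℕ} :
    Tendsto (fun n : ℕ => ((n / m : ℕ) : ℝ) / n) atTop (nhds ((m : ℝ)⁻¹)) := by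
  have h := (tendsto_nat_floor_mul_div_atTop (R := ℝ) (a := (m : ℝ)⁻¹)
    (by positivity)).comp tendsto_natCast_atTop_atTop
  refine h.congr fun n => ?_
  simp only [Function.comp_apply]
  rw [inv_mul_eq_div, Nat.floor_div_eq_div]

/-- The limit densities of the nested colorings increase to `1 / (k ^ k - k)`. -/
lemma tendsto_sum_nested_density (hk : 2 ≤ k) :
    Tendsto (fun L => ∑ l ∈ Finset.range L, (k : ℝ) ^ l * (((k ^ (l + 1) : ℕ) : ℝ)⁻¹) ^ k)
      atTop (nhds (1 / ((k : ℝ) ^ k - k))) := by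
  have hk0 : (0 : ℝ) < k := by exact_mod_cast (by omega : 0 < k)
  have hlt := self_lt_pow_self_real hk
  have hr : (k : ℝ) / (k : ℝ) ^ k < 1 := (div_lt_one (by positivity)).2 hlt
  have h := ((hasSum_geometric_of_lt_one (by positivity) hr).mul_left
    (((k : ℝ) ^ k)⁻¹)).tendsto_sum_nat
  have hlim : ((k : ℝ) ^ k)⁻¹ * (1 - (k : ℝ) / (k : ℝ) ^ k)⁻¹ = 1 / ((k : ℝ) ^ k - k) := by
    rw [← mul_inv, mul_sub, mul_one, mul_div_cancel₀ _ (by positivity), one_div]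
  rw [hlim] at h
  refine h.congr fun L => Finset.sum_congr rfl fun l _ => ?_
  push_cast
  rw [div_pow, inv_pow, ← pow_mul, ← pow_mul, add_mul, one_mul, pow_add, mul_inv, mul_comm l k]
  ring

lemma tendsto_maxCopyCount (hk : 2 ≤ k) (hG : G.Connected)
    (hdeg : ∀ i, 40 * Real.log k ≤ degR G i) :
    Tendsto (fun n : ℕ => (maxCopyCount k n (rainbowOf G) : ℝ) / (n.choose k : ℝ)) atTop
      (nhds ((k.factorial : ℝ) / ((k : ℝ) ^ k - k))) := by
  refine tendsto_order.2 ⟨fun a ha => ?_, fun a ha => ?_⟩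
  · have hS := (tendsto_sum_nested_density hk).mul_const (k.factorial : ℝ)
    rw [one_div_mul_eq_div] at hS
    obtain ⟨L, hL⟩ := (hS.eventually_const_lt ha).exists
    have hlow := (tendsto_finsetSum (Finset.range L) fun l _ =>
      ((tendsto_nat_div_div (m := k ^ (l + 1))).pow k).const_mul ((k : ℝ) ^ l)).mul
        (tendsto_pow_div_choose k)
    filter_upwards [hlow.eventually_const_lt hL, eventually_gt_atTop 0] with n hn hn0
    refine hn.trans_le ?_
    have hn0' : (n : ℝ) ≠ 0 := by exact_mod_cast hn0.ne'
    have hle : (∑ l ∈ Finset.range L, (k : ℝ) ^ l * ((n / k ^ (l + 1) : ℕ) : ℝ) ^ k) ≤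
        maxCopyCount k n (rainbowOf G) := by
      exact_mod_cast le_maxCopyCount hk hG (exists_adj_ne hk hdeg) L n
    refine le_trans (le_of_eq ?_) (div_le_div_of_nonneg_right hle (Nat.cast_nonneg _))
    rw [← mul_div_assoc, Finset.sum_mul]
    congr 1
    refine Finset.sum_congr rfl fun l _ => ?_
    rw [div_pow, mul_assoc, div_mul_cancel₀ _ (pow_ne_zero k hn0')]
  · have hup := (tendsto_pow_div_choose k).div_const ((k : ℝ) ^ k - k)
    filter_upwards [hup.eventually_lt_const ha] with n hn
    refine lt_of_le_of_lt ?_ hn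
    rw [div_right_comm]
    exact div_le_div_of_nonneg_right (maxCopyCount_le hk hG hdeg n) (Nat.cast_nonneg _)

end Limit

/-- There is an absolute constant `C > 0` such that for every `k ≥ 2` and every
connected rainbow graph `R` on `k` vertices with minimum degree at least `C log k`,
`I(R,n)/binom(n,k)` converges to `k!/(k^k − k)`. -/
theorem sparse_rainbow_graph_inducibility :
    ∃ C : ℝ, 0 < C ∧ ∀ k : ℕ, 2 ≤ k → ∀ G : SimpleGraph (Fin k),
      G.Connected →
      (∀ i : Fin k, C * Real.log k ≤ (degR G i : ℝ)) →
      Filter.Tendsto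
        (fun n : ℕ => (maxCopyCount k n (rainbowOf G) : ℝ) / (n.choose k : ℝ))
        Filter.atTop (nhds ((k.factorial : ℝ) / ((k : ℝ) ^ k - k))) := by
  exact ⟨40, by norm_num, fun k hk G hG hdeg => tendsto_maxCopyCount hk hG hdeg⟩
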